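/- arXiv:1602.01963 — 2 statements merged into one kernel-verified Lean document; each statement's English description precedes it below -/
import Mathlib

section
/- Let G be a parity game, j ∈ {0,1} a player, and X a fatal attractor for player j in G. Then X is contained in the winning core of player j: X ⊆ A_j(G). -/
/-- A parity game: an owner (player `0` or `1`) for each state, a total
transition relation `R` and a coloring `c` of the states. -/
structure ParityGame (S : Type) where
  owner : S → Fin 2
  R : S → S → Prop
  total : ∀ s, ∃ t, R s t
  c : S → ℕ

namespace ParityGame

variable {S : Type}

/-- The value `e` occurs infinitely often in the sequence `π`. -/
def InfOften (π : ℕ → ℕ) (e : ℕ) : Prop := ∀ n, ∃ i, n ≤ i ∧ π i = e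

/-- `π ∈ Ω_j` : `π` is bounded and the largest value occurring infinitely often
in `π` is congruent to `j` mod 2. -/
def InOmega (j : Fin 2) (π : ℕ → ℕ) : Prop :=
  (∃ k, ∀ i, π i ≤ k) ∧
  ∃ e, InfOften π e ∧ (∀ e', InfOften π e' → e' ≤ e) ∧ e % 2 = (j : ℕ)

/-- `π ∈ Λ_j` : `π ∈ Ω_j` and the largest non-initial entry of `π` is congruent
to `j` mod 2. -/
def InLambda (j : Fin 2) (π : ℕ → ℕ) : Prop :=
  InOmega j π ∧ ∃ i, 1 ≤ i ∧ (∀ k, 1 ≤ k → π k ≤ π i) ∧ π i % 2 = (j : ℕ)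

variable (G : ParityGame S)

/-- A play: an infinite sequence of states respecting the transition relation. -/
def IsPlay (ρ : ℕ → S) : Prop := ∀ i, G.R (ρ i) (ρ (i + 1))

/-- A strategy is modelled as a function from (past history, current state) to a
successor of the current state. -/
def IsStrategy (σ : List S → S → S) : Prop := ∀ h s, G.R s (σ h s)

/-- A play is compatible with a strategy `σ` of player `j` if at every state owned
by `j` the play follows `σ` (applied to the history so far). -/
def Compatible (j : Fin 2) (σ : List S → S → S) (ρ : ℕ → S) : Prop :=
  ∀ i, G.owner (ρ i) = j → ρ (i + 1) = σ (List.ofFn fun k : Fin i => ρ k.val) (ρ i)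

/-- A strategy is memoryless if it only depends on the current state. -/
def Memoryless (σ : List S → S → S) : Prop := ∀ h h' s, σ h s = σ h' s

/-- The color sequence of a play. -/
def colorSeq (ρ : ℕ → S) : ℕ → ℕ := fun i => G.c (ρ i)

/-- The segment `ρ_a ρ_{a+1} ... ρ_b` is `j`-dominating: it has at least one
transition and the largest color among its non-initial states is ≡ j (mod 2). -/
def SegDom (j : Fin 2) (ρ : ℕ → S) (a b : ℕ) : Prop :=
  a < b ∧ ((Finset.Icc (a + 1) b).sup fun k => G.c (ρ k)) % 2 = (j : ℕ)

/-- The play `ρ` begins with an infinite number of consecutive `j`-dominating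
sequences. -/
def BeginsInfDom (j : Fin 2) (ρ : ℕ → S) : Prop :=
  ∃ idx : ℕ → ℕ, idx 0 = 0 ∧ ∀ ℓ, G.SegDom j ρ (idx ℓ) (idx (ℓ + 1))

/-- The play `ρ` begins with (at least) `k` consecutive `j`-dominating sequences. -/
def BeginsKDom (j : Fin 2) (ρ : ℕ → S) (k : ℕ) : Prop :=
  ∃ idx : ℕ → ℕ, idx 0 = 0 ∧ ∀ ℓ < k, G.SegDom j ρ (idx ℓ) (idx (ℓ + 1))

/-- The (infinite) play `ρ` is itself `j`-dominating : the largest color among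
its non-initial states is ≡ j (mod 2). -/
def PlayDom (j : Fin 2) (ρ : ℕ → S) : Prop :=
  ∃ i, 1 ≤ i ∧ (∀ k, 1 ≤ k → G.c (ρ k) ≤ G.c (ρ i)) ∧ G.c (ρ i) % 2 = (j : ℕ)

/-- The winning region `W_j(G)` of player `j`. -/
def WinRegion (j : Fin 2) : Set S :=
  {s | ∃ σ, G.IsStrategy σ ∧ ∀ ρ, G.IsPlay ρ → ρ 0 = s → G.Compatible j σ ρ →
    InOmega j (G.colorSeq ρ)}

/-- The winning core `A_j(G)` of player `j`. -/
def WinCore (j : Fin 2) : Set S :=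
  {s | ∃ σ, G.IsStrategy σ ∧ ∀ ρ, G.IsPlay ρ → ρ 0 = s → G.Compatible j σ ρ →
    G.BeginsInfDom j ρ}

/-- `A^k_j(G)` : states from which player `j` can ensure that the play begins
with at least `k` consecutive `j`-dominating sequences. -/
def WinCoreK (j : Fin 2) (k : ℕ) : Set S :=
  {s | ∃ σ, G.IsStrategy σ ∧ ∀ ρ, G.IsPlay ρ → ρ 0 = s → G.Compatible j σ ρ →
    G.BeginsKDom j ρ k}

/-- The restricted parity game `G ↾ T` (given that the restricted transition
relation is total). -/
def restrict (T : Set S) (h : ∀ s : T, ∃ t : T, G.R s.1 t.1) : ParityGame T where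
  owner s := G.owner s.1
  R a b := G.R a.1 b.1
  total := h
  c s := G.c s.1

end ParityGame

/-- Membership in the attractor `Attr_j(G, T)` : the least set containing `T`,
closed under adding states from which player `j` controls reaching it. -/
inductive ParityGame.AttrRel {S : Type} (G : ParityGame S) (j : Fin 2) (T : Set S) : S → Prop
  | base {s} : s ∈ T → AttrRel G j T s
  | own {s t} : G.owner s = j → G.R s t → AttrRel G j T t → AttrRel G j T s
  | opp {s} : G.owner s ≠ j → (∀ t, G.R s t → AttrRel G j T t) → AttrRel G j T s

namespace ParityGame

variable {S : Type} (G : ParityGame S)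

/-- The attractor `Attr_j(G, T)` as a set. -/
def attractor (j : Fin 2) (T : Set S) : Set S := {s | AttrRel G j T s}

/-- The positive attractor `Attr⁺_j(G, T)`. -/
def posAttractor (j : Fin 2) (T : Set S) : Set S :=
  G.attractor j ({s | G.owner s = j ∧ ∃ t ∈ T, G.R s t} ∪
                 {s | G.owner s ≠ j ∧ ∀ t, G.R s t → t ∈ T})

/-- The product game `G†_j` over states `S × {0, ..., d}`. -/
def prodGame (j : Fin 2) (d : ℕ) (hc : ∀ s, G.c s ≤ d) :
    ParityGame (S × Fin (d + 1)) where
  owner p := G.owner p.1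
  R p q := G.R p.1 q.1 ∧ (q.2 : ℕ) = max (p.2 : ℕ) (G.c q.1)
  total p := by
    obtain ⟨t, ht⟩ := G.total p.1
    refine ⟨(t, ⟨max (p.2 : ℕ) (G.c t), ?_⟩), ht, rfl⟩
    exact Nat.lt_succ_iff.mpr (max_le (Nat.lt_succ_iff.mp p.2.isLt) (hc t))
  c p := if (p.2 : ℕ) % 2 = (j : ℕ) then G.c p.1 else (p.2 : ℕ)

/-- `X` is a fatal attractor for player `j`: all states in `X` have the same
color `e ≡ j (mod 2)` and from every state of `X` player `j` can force the play
back to `X` without passing a color greater than `e`. -/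
def FatalAttractor (j : Fin 2) (X : Set S) : Prop :=
  ∃ e, e % 2 = (j : ℕ) ∧ (∀ s ∈ X, G.c s = e) ∧
    ∀ s ∈ X, ∃ σ, G.IsStrategy σ ∧ ∀ ρ, G.IsPlay ρ → ρ 0 = s → G.Compatible j σ ρ →
      ∃ k, 0 < k ∧ ρ k ∈ X ∧ ∀ i, 0 < i → i ≤ k → G.c (ρ i) ≤ e

/-- `T` is `j`-closed: player `j` can force the play to stay in `T`. -/
def JClosed (j : Fin 2) (T : Set S) : Prop :=
  (∀ s ∈ T, G.owner s ≠ j → ∀ t, G.R s t → t ∈ T) ∧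
  (∀ s ∈ T, G.owner s = j → ∃ t ∈ T, G.R s t)

/-- The restriction of `G` to a `j`-closed set has a total transition relation. -/
theorem JClosed.totalOn {G : ParityGame S} {j : Fin 2} {T : Set S}
    (h : G.JClosed j T) : ∀ s : T, ∃ t : T, G.R s.1 t.1 := by
  rintro ⟨s, hs⟩
  by_cases hj : G.owner s = j
  · obtain ⟨t, ht, hrt⟩ := h.2 s hs hj
    exact ⟨⟨t, ht⟩, hrt⟩
  · obtain ⟨t, hrt⟩ := G.total s
    exact ⟨⟨t, h.1 s hs hj t hrt⟩, hrt⟩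

end ParityGame

namespace ParityGame

/-- The sequence `B^i_j(G)` of under-approximations of the winning core. -/
def Bset {S : Type} (G : ParityGame S) (j : Fin 2) : ℕ → Set S
  | 0 => Set.univ
  | i + 1 =>
    {s | s ∈ Bset G j i ∧ ∃ σ, G.IsStrategy σ ∧ ∀ ρ, G.IsPlay ρ → ρ 0 = s →
      G.Compatible j σ ρ → ∃ k, G.SegDom j ρ 0 k ∧ ρ k ∈ Bset G j i}

open Classical in
/-- Rank of a color sequence according to the order
`Λ₁ ◁ Ω₁ \ Λ₁ ◁ Ω₀ \ Λ₀ ◁ Λ₀`; the preference relation `≤₀` of player 0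
compares these ranks. -/
noncomputable def prefRank (π : ℕ → ℕ) : ℕ :=
  if InLambda 0 π then 3
  else if InOmega 0 π then 2
  else if InLambda 1 π then 0
  else 1

/-- The reward order `≺_j` on colors. -/
def RewardLt (j : Fin 2) (v u : ℕ) : Prop :=
  (v < u ∧ u % 2 = (j : ℕ)) ∨ (u < v ∧ v % 2 = ((1 - j : Fin 2) : ℕ))

end ParityGame

open ParityGame

theorem ParityGame.extend_play {S : Type} (G : ParityGame S) (j : Fin 2)
    (τ : List S → S → S) (hτ : G.IsStrategy τ) (π : ℕ → S) (m : ℕ)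
    (hπ : ∀ i < m, G.R (π i) (π (i + 1)))
    (hc : ∀ i < m, G.owner (π i) = j →
      π (i + 1) = τ (List.ofFn fun k : Fin i => π k.val) (π i)) :
    ∃ ρ, G.IsPlay ρ ∧ G.Compatible j τ ρ ∧ ∀ i ≤ m, ρ i = π i := by
  let f : ℕ → List S × S := fun n => Nat.rec ([], π 0)
    (fun i p => (p.1 ++ [p.2], if i < m then π (i + 1) else τ p.1 p.2)) n
  have f0 : f 0 = ([], π 0) := rfl
  have fs : ∀ i, f (i + 1) =
    ((f i).1 ++ [(f i).2], if i < m then π (i + 1) else τ (f i).1 (f i).2) := fun i => rfl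
  have hl : ∀ i, (f i).1 = List.ofFn (fun k : Fin i => (f k.val).2) := by
    intro i
    induction i with
    | zero => simp [f0]
    | succ i ih =>
      rw [List.ofFn_succ', List.concat_eq_append, fs]
      simp [ih]
  have he : ∀ i ≤ m, (f i).2 = π i := by
    intro i hi
    cases i with
    | zero => rfl
    | succ i =>
      rw [fs]
      have : i < m := hi
      simp [this]
  refine ⟨fun i => (f i).2, ?_, ?_, he⟩
  · intro i
    by_cases h : i < m
    · have := hπ i h
      rw [← he i h.le, ← he (i + 1) h] at this
      exact this
    · have : (f (i + 1)).2 = τ (f i).1 (f i).2 := by rw [fs]; simp [h]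
      show G.R (f i).2 (f (i + 1)).2
      rw [this]
      exact hτ _ _
  · intro i ho
    show (f (i + 1)).2 = _
    by_cases h : i < m
    · have hk : (List.ofFn fun k : Fin i => (f k.val).2) = List.ofFn fun k : Fin i => π k.val := by
        congr 1
        funext k
        exact he _ (by omega)
      dsimp only at ho ⊢
      rw [hk, he i h.le, he (i + 1) h]
      rw [he i h.le] at ho
      exact hc i h ho
    · rw [← hl i, fs]
      simp [h]

open Classical in
noncomputable def ParityGame.curStep {S : Type} (X : Set S) (acc : List S) (a : S) : List S :=
  if a ∈ X then [a] else acc ++ [a]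

theorem ParityGame.cur_ofFn {S : Type} (X : Set S) (ρ : ℕ → S) (n : ℕ) (hn : ρ n ∈ X) (m : ℕ)
    (hm : ∀ i < m, ρ (n + (i + 1)) ∉ X) :
    (List.ofFn fun k : Fin (n + (m + 1)) => ρ k.val).foldl (curStep X) [] =
      List.ofFn fun k : Fin (m + 1) => ρ (n + k.val) := by
  induction m with
  | zero =>
    show (List.ofFn fun k : Fin (n + 1) => ρ k.val).foldl (curStep X) [] = _
    rw [List.ofFn_succ', List.concat_eq_append, List.foldl_append]
    simp [curStep, hn]
  | succ m ih =>
    have ih := ih (fun i hi => hm i (by omega))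
    show (List.ofFn fun k : Fin ((n + (m + 1)) + 1) => ρ k.val).foldl (curStep X) [] = _
    rw [List.ofFn_succ', List.concat_eq_append, List.foldl_append]
    rw [List.ofFn_succ' (n := m + 1), List.concat_eq_append]
    have h2 := hm m (by omega)
    simp only [Fin.val_castSucc, Fin.val_last, List.foldl_cons, List.foldl_nil]
    rw [ih]
    simp [curStep, h2]

/-- Every fatal attractor `X` for player `j` is contained in the
winning core of player `j`: `X ⊆ A_j(G)`. -/
theorem fatalAttractor_subset_winCore {S : Type} [Fintype S] (G : ParityGame S)
    (j : Fin 2) (X : Set S) (hX : G.FatalAttractor j X) :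
    X ⊆ G.WinCore j := by
  classical
  obtain ⟨e, hej, hXe, hF⟩ := hX
  have hF' : ∀ s, ∃ σ, G.IsStrategy σ ∧ (s ∈ X → ∀ ρ, G.IsPlay ρ → ρ 0 = s →
      G.Compatible j σ ρ → ∃ k, 0 < k ∧ ρ k ∈ X ∧ ∀ i, 0 < i → i ≤ k → G.c (ρ i) ≤ e) := by
    intro s
    by_cases hs : s ∈ X
    · obtain ⟨σ, h1, h2⟩ := hF s hs
      exact ⟨σ, h1, fun _ => h2⟩
    · choose g hg using G.total
      exact ⟨fun _ s => g s, fun _ s => hg s, fun h => absurd h hs⟩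
  choose τ hτ hτX using hF'
  intro x hx
  refine ⟨fun h s => if s ∈ X then τ s [] s else
    τ ((h.foldl (curStep X) []).headD s) (h.foldl (curStep X) []) s, ?_, ?_⟩
  · intro h s
    dsimp only
    split_ifs <;> exact hτ _ _ _
  intro ρ hρ h0 hcomp
  -- compatibility of shifted segments
  have key : ∀ n, ρ n ∈ X → ∀ i, (∀ k < i, ρ (n + (k + 1)) ∉ X) → G.owner (ρ (n + i)) = j →
      ρ (n + (i + 1)) = τ (ρ n) (List.ofFn fun k : Fin i => ρ (n + k.val)) (ρ (n + i)) := by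
    intro n hn i hi ho
    have hc := hcomp (n + i) ho
    cases i with
    | zero => simpa [hn] using hc
    | succ i =>
      dsimp only at hc
      rw [if_neg (hi i (by omega)), cur_ofFn X ρ n hn i (fun k hk => hi k (by omega))] at hc
      rw [← Nat.add_assoc n (i + 1) 1, hc]
      congr 1
      simp [List.ofFn_succ]
  have ret : ∀ n, ρ n ∈ X → ∃ m, n < m ∧ ρ m ∈ X ∧ ∀ i, n < i → i ≤ m → G.c (ρ i) ≤ e := by
    intro n hn
    by_cases hex : ∃ m, ρ (n + (m + 1)) ∈ X
    · have hm := Nat.find_spec hex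
      have hmin : ∀ k < Nat.find hex, ρ (n + (k + 1)) ∉ X := fun k hk => Nat.find_min hex hk
      generalize Nat.find hex = m at hm hmin
      obtain ⟨π, hp, hpc, hpe⟩ := G.extend_play j (τ (ρ n)) (hτ _) (fun i => ρ (n + i)) (m + 1)
        (fun i _ => hρ (n + i))
        (fun i hi ho => key n hn i (fun k hk => hmin k (by omega)) ho)
      obtain ⟨k, hk0, hkX, hk⟩ := hτX (ρ n) hn π hp (hpe 0 (by omega)) hpc
      have hkm : m + 1 ≤ k := by
        by_contra hlt
        obtain ⟨k, rfl⟩ : ∃ k', k = k' + 1 := ⟨k - 1, by omega⟩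
        rw [hpe (k + 1) (by omega)] at hkX
        exact hmin k (by omega) hkX
      refine ⟨n + (m + 1), by omega, hm, fun i hi him => ?_⟩
      have := hk (i - n) (by omega) (by omega)
      rw [hpe (i - n) (by omega)] at this
      simpa [Nat.add_sub_cancel' hi.le] using this
    · push Not at hex
      obtain ⟨k, hk0, hkX, _⟩ := hτX (ρ n) hn (fun i => ρ (n + i)) (fun i => hρ (n + i)) rfl
        (fun i ho => key n hn i (fun k _ => hex k) ho)
      obtain ⟨k, rfl⟩ : ∃ k', k = k' + 1 := ⟨k - 1, by omega⟩
      exact absurd hkX (hex k)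
  choose! nx h1 h2 h3 using ret
  have hidx : ∀ l, ρ (nx^[l] 0) ∈ X := by
    intro l
    induction l with
    | zero => simpa [h0] using hx
    | succ l ih => rw [Function.iterate_succ_apply']; exact h2 _ ih
  refine ⟨fun l => nx^[l] 0, rfl, fun l => ?_⟩
  have hl := hidx l
  dsimp only
  rw [Function.iterate_succ_apply']
  generalize nx^[l] 0 = n at hl
  refine ⟨h1 n hl, ?_⟩
  have : ((Finset.Icc (n + 1) (nx n)).sup fun k => G.c (ρ k)) = e := by
    apply le_antisymm
    · apply Finset.sup_le
      intro i hi
      rw [Finset.mem_Icc] at hi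
      exact h3 n hl i (by omega) hi.2
    · rw [← hXe _ (h2 n hl)]
      exact Finset.le_sup (f := fun k => G.c (ρ k)) (Finset.mem_Icc.mpr ⟨h1 n hl, le_rfl⟩)
  rw [this, hej]
end

section
/- Let G be a parity game with colors in {1,...,d}, j ∈ {0,1} a player, G†_j its product game, and s a state of G. If s ∈ A_j(G), then (s, 0) ∈ W_j(G†_j). -/
open ParityGame

theorem exists_max_infOften (π : ℕ → ℕ) (k : ℕ) (hk : ∀ i, π i ≤ k) :
    ∃ e n, InfOften π e ∧ ∀ i, n ≤ i → π i ≤ e := by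
  classical
  have hex : ∃ e, ∃ n, ∀ i, n ≤ i → π i ≤ e := ⟨k, 0, fun i _ => hk i⟩
  obtain ⟨n, hn⟩ := Nat.find_spec hex
  refine ⟨Nat.find hex, n, ?_, hn⟩
  intro m
  by_contra hcon
  push Not at hcon
  have hlt : ∀ i, max n m ≤ i → π i < Nat.find hex := fun i hi =>
    lt_of_le_of_ne (hn i (le_trans (le_max_left _ _) hi))
      (hcon i (le_trans (le_max_right _ _) hi))
  have h0 : Nat.find hex - 1 < Nat.find hex := by
    have := hlt _ le_rfl
    omega
  exact Nat.find_min hex h0 ⟨max n m, fun i hi => by have := hlt i hi; omega⟩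

/-- If `s ∈ A_j(G)` then `(s, 0) ∈ W_j(G†_j)` in the product
game `G†_j`. -/
theorem mem_winRegion_prodGame_of_mem_winCore {S : Type} [Fintype S] (G : ParityGame S)
    (j : Fin 2) (d : ℕ) (hc : ∀ s, 1 ≤ G.c s ∧ G.c s ≤ d) (s : S)
    (hs : s ∈ G.WinCore j) :
    ((s, (0 : Fin (d + 1))) : S × Fin (d + 1)) ∈
      (G.prodGame j d fun t => (hc t).2).WinRegion j := by
  classical
  obtain ⟨σ, hσ, hwin⟩ := hs
  have hbd : ∀ (v : Fin (d + 1)) (t : S), max (v : ℕ) (G.c t) < d + 1 := fun v t =>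
    Nat.lt_succ_iff.mpr (max_le (Nat.lt_succ_iff.mp v.isLt) (hc t).2)
  refine ⟨fun h p => (σ (h.map Prod.fst) p.1, ⟨_, hbd p.2 (σ (h.map Prod.fst) p.1)⟩),
    fun h p => ⟨hσ _ _, rfl⟩, ?_⟩
  intro ρ hplay h0 hcomp
  obtain ⟨idx, hidx0, hseg⟩ := hwin (fun i => (ρ i).1) (fun i => (hplay i).1)
    (by simp [h0]) (by
      intro i hi
      have := congrArg Prod.fst (hcomp i hi)
      simpa [List.map_ofFn, Function.comp_def] using this)
  have hmono : StrictMono idx := strictMono_nat_of_lt_succ fun ℓ => (hseg ℓ).1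
  have hv0 : ((ρ 0).2 : ℕ) = 0 := by simp [h0]
  have hstep : ∀ i, ((ρ (i + 1)).2 : ℕ) = max ((ρ i).2 : ℕ) (G.c (ρ (i + 1)).1) :=
    fun i => (hplay i).2
  have hsup : ∀ a n, ((ρ (a + n)).2 : ℕ) =
      max ((ρ a).2 : ℕ) ((Finset.Icc (a + 1) (a + n)).sup fun k => G.c (ρ k).1) := by
    intro a n
    induction n with
    | zero => simp
    | succ n ih =>
      have hI : Finset.Icc (a + 1) (a + (n + 1)) =
          insert (a + n + 1) (Finset.Icc (a + 1) (a + n)) := by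
        ext x; simp only [Finset.mem_Icc, Finset.mem_insert]; omega
      rw [hI, Finset.sup_insert, ← add_assoc, hstep, ih, max_assoc]
      congr 1
      exact max_comm _ _
  have hpar : ∀ ℓ, ((ρ (idx (ℓ + 1))).2 : ℕ) % 2 = (j : ℕ) := by
    have key : ∀ ℓ, ((ρ (idx (ℓ + 1))).2 : ℕ) = max ((ρ (idx ℓ)).2 : ℕ)
        ((Finset.Icc (idx ℓ + 1) (idx (ℓ + 1))).sup fun k => G.c (ρ k).1) := by
      intro ℓ
      have := hsup (idx ℓ) (idx (ℓ + 1) - idx ℓ)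
      rwa [Nat.add_sub_cancel' (hseg ℓ).1.le] at this
    intro ℓ
    induction ℓ with
    | zero =>
      rw [key 0, hidx0, hv0, Nat.zero_max]
      have := (hseg 0).2
      rwa [hidx0] at this
    | succ ℓ ih =>
      rw [key (ℓ + 1)]
      rcases max_choice ((ρ (idx (ℓ + 1))).2 : ℕ)
        ((Finset.Icc (idx (ℓ + 1) + 1) (idx (ℓ + 1 + 1))).sup fun k => G.c (ρ k).1)
        with h | h
      · rw [h]; exact ih
      · rw [h]; exact (hseg (ℓ + 1)).2
  have hvmono : Monotone fun i => ((ρ i).2 : ℕ) :=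
    monotone_nat_of_le_succ fun i => by rw [hstep i]; exact le_max_left _ _
  -- eventually the second component has parity `j`
  have hev : ∃ N, ∀ i, N ≤ i → ((ρ i).2 : ℕ) % 2 = (j : ℕ) := by
    obtain ⟨e, n, he, hn⟩ := exists_max_infOften (fun i => ((ρ i).2 : ℕ)) d
      (fun i => Nat.lt_succ_iff.mp (ρ i).2.isLt)
    obtain ⟨N, hN, hNe⟩ := he n
    have hconst : ∀ i, N ≤ i → ((ρ i).2 : ℕ) = e := fun i hi =>
      le_antisymm (hn i (hN.trans hi)) (hNe ▸ hvmono hi)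
    refine ⟨N, fun i hi => ?_⟩
    rw [hconst i hi, ← hpar N]
    rw [hconst _ ((Nat.le_succ N).trans (hmono.id_le (N + 1)))]
  obtain ⟨N, hN⟩ := hev
  have hcol : ∀ i, N ≤ i →
      (G.prodGame j d fun t => (hc t).2).colorSeq ρ i = G.c (ρ i).1 := fun i hi =>
    if_pos (hN i hi)
  have hbound : ∀ i, (G.prodGame j d fun t => (hc t).2).colorSeq ρ i ≤ d := by
    intro i
    simp only [colorSeq, prodGame]
    split_ifs
    · exact (hc _).2
    · exact Nat.lt_succ_iff.mp (ρ i).2.isLt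
  refine ⟨⟨d, hbound⟩, ?_⟩
  obtain ⟨e, n, he, hn⟩ := exists_max_infOften _ d hbound
  refine ⟨e, he, ?_, ?_⟩
  · intro e' he'
    obtain ⟨i, hi, rfl⟩ := he' n
    exact hn i hi
  · obtain ⟨i, hi, hie⟩ := he (idx (max n N) + 1)
    have hex : ∃ m, i ≤ idx m := ⟨i, hmono.id_le i⟩
    have hm := Nat.find_spec hex
    have hmin : ∀ m, m < Nat.find hex → ¬ i ≤ idx m := fun m h => Nat.find_min hex h
    generalize Nat.find hex = m at hm hmin
    have hlt : max n N < m := by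
      rw [← hmono.lt_iff_lt]; omega
    obtain ⟨q, rfl⟩ : ∃ q, m = q + 1 := ⟨m - 1, by omega⟩
    have hq := hmin q (Nat.lt_succ_self q)
    have hge : max n N ≤ idx q := (Nat.lt_succ_iff.mp hlt).trans (hmono.id_le q)
    have hnq : n ≤ idx q := (le_max_left _ _).trans hge
    have hNq : N ≤ idx q := (le_max_right _ _).trans hge
    have hs := (hseg q).2
    have hse : ((Finset.Icc (idx q + 1) (idx (q + 1))).sup fun k => G.c (ρ k).1) = e := by
      apply le_antisymm
      · apply Finset.sup_le
        intro k hk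
        rw [Finset.mem_Icc] at hk
        rw [← hcol k (by omega)]
        exact hn k (by omega)
      · rw [← hie, hcol i (by omega)]
        exact Finset.le_sup (f := fun k => G.c (ρ k).1)
          (Finset.mem_Icc.mpr ⟨by omega, hm⟩)
    rw [← hse]
    exact hs
end
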